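/- Let a ≥ 0, N ≥ 3 and 1 < p < (N+2+2a)/(N−2). Let u be a positive C² solution of −Δu = |x|^a u^p on ℝ^N that is stable outside a compact set. Then ((N−2)/2) ∫_{ℝ^N} |∇u|² = ((N+a)/(p+1)) ∫_{ℝ^N} |x|^a u^{p+1}; combined with the energy identity ∫ |∇u|² = ∫ |x|^a u^{p+1}, this forces ((N+a)/(p+1) − (N−2)/2) ∫_{ℝ^N} |x|^a u^{p+1} = 0. -/

import Mathlib

open MeasureTheory Real Metric

/-- The Laplacian of a function on Euclidean space, as the sum of its second
partial derivatives in the coordinate directions. -/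
noncomputable def lap {N : ℕ} (f : EuclideanSpace ℝ (Fin N) → ℝ)
    (x : EuclideanSpace ℝ (Fin N)) : ℝ :=
  ∑ i : Fin N,
    fderiv ℝ (fun y => fderiv ℝ f y (EuclideanSpace.single i 1)) x (EuclideanSpace.single i 1)

namespace Henon

open Filter Topology

/-- The `i`-th partial derivative. -/
noncomputable def D {N : ℕ} (i : Fin N) (f : EuclideanSpace ℝ (Fin N) → ℝ)
    (x : EuclideanSpace ℝ (Fin N)) : ℝ :=
  fderiv ℝ f x (EuclideanSpace.single i 1)

/-- The inner product of two gradients, in coordinates. -/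
noncomputable def P {N : ℕ} (f g : EuclideanSpace ℝ (Fin N) → ℝ)
    (x : EuclideanSpace ℝ (Fin N)) : ℝ :=
  ∑ i, D i f x * D i g x

variable {N : ℕ}

lemma lap_eq (f : EuclideanSpace ℝ (Fin N) → ℝ) (x : EuclideanSpace ℝ (Fin N)) :
    lap f x = ∑ i, D i (D i f) x := rfl

lemma fderiv_eq_sum (f : EuclideanSpace ℝ (Fin N) → ℝ) (x v : EuclideanSpace ℝ (Fin N)) :
    fderiv ℝ f x v = ∑ i, v i * D i f x := by
  have h : v = ∑ i, v i • EuclideanSpace.single i (1 : ℝ) := by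
    ext j
    simp [Finset.sum_apply, Pi.single_apply]
  conv_lhs => rw [h]
  simp [D]

lemma P_eq_norm (f : EuclideanSpace ℝ (Fin N) → ℝ) (x : EuclideanSpace ℝ (Fin N)) :
    P f f x = ‖gradient f x‖ ^ 2 := by
  rw [EuclideanSpace.real_norm_sq_eq]
  unfold P
  refine Finset.sum_congr rfl fun i _ => ?_
  have : D i f x = gradient f x i := by
    unfold D
    rw [← toDual_gradient, InnerProductSpace.toDual_apply_apply, EuclideanSpace.inner_single_right]
    simp only [one_mul]
    rfl
  rw [this, sq]

lemma norm_gradient_eq (f : EuclideanSpace ℝ (Fin N) → ℝ) (x : EuclideanSpace ℝ (Fin N)) :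
    ‖gradient f x‖ = ‖fderiv ℝ f x‖ := by
  rw [← toDual_gradient, LinearIsometryEquiv.norm_map]

lemma P_eq_norm' (f : EuclideanSpace ℝ (Fin N) → ℝ) (x : EuclideanSpace ℝ (Fin N)) :
    P f f x = ‖fderiv ℝ f x‖ ^ 2 := by
  rw [P_eq_norm, norm_gradient_eq]

lemma contDiff_D {f : EuclideanSpace ℝ (Fin N) → ℝ} (hf : ContDiff ℝ 2 f) (i : Fin N) :
    ContDiff ℝ 1 (D i f) :=
  (hf.fderiv_right (m := 1) (by norm_num)).clm_apply contDiff_const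

lemma continuous_D {f : EuclideanSpace ℝ (Fin N) → ℝ} (hf : ContDiff ℝ 1 f) (i : Fin N) :
    Continuous (D i f) :=
  (hf.continuous_fderiv one_ne_zero).clm_apply continuous_const

lemma continuous_P {f g : EuclideanSpace ℝ (Fin N) → ℝ} (hf : ContDiff ℝ 1 f)
    (hg : ContDiff ℝ 1 g) : Continuous (P f g) :=
  continuous_finsetSum _ fun i _ => (continuous_D hf i).mul (continuous_D hg i)

lemma D_mul {f g : EuclideanSpace ℝ (Fin N) → ℝ} {x : EuclideanSpace ℝ (Fin N)}
    (hf : DifferentiableAt ℝ f x) (hg : DifferentiableAt ℝ g x) (i : Fin N) :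
    D i (fun y => f y * g y) x = D i f x * g x + f x * D i g x := by
  unfold D
  rw [fderiv_fun_mul hf hg]
  simp; ring

lemma D_sub {f g : EuclideanSpace ℝ (Fin N) → ℝ} {x : EuclideanSpace ℝ (Fin N)}
    (hf : DifferentiableAt ℝ f x) (hg : DifferentiableAt ℝ g x) (i : Fin N) :
    D i (fun y => f y - g y) x = D i f x - D i g x := by
  unfold D
  rw [fderiv_fun_sub hf hg]
  simp

lemma D_sum {f : Fin N → EuclideanSpace ℝ (Fin N) → ℝ} {x : EuclideanSpace ℝ (Fin N)}
    (hf : ∀ j, DifferentiableAt ℝ (f j) x) (i : Fin N) :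
    D i (fun y => ∑ j, f j y) x = ∑ j, D i (f j) x := by
  unfold D
  rw [fderiv_fun_sum (fun j _ => hf j)]
  simp

lemma D_const_mul {f : EuclideanSpace ℝ (Fin N) → ℝ} {x : EuclideanSpace ℝ (Fin N)}
    (hf : DifferentiableAt ℝ f x) (c : ℝ) (i : Fin N) :
    D i (fun y => c * f y) x = c * D i f x := by
  unfold D
  rw [fderiv_const_mul hf]
  simp

lemma contDiff_coord (j : Fin N) (n : ℕ∞) : 
    ContDiff ℝ n (fun y : EuclideanSpace ℝ (Fin N) => y j) :=
  (EuclideanSpace.proj (𝕜 := ℝ) j).contDiff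

lemma D_coord (i j : Fin N) (x : EuclideanSpace ℝ (Fin N)) :
    D i (fun y => y j) x = if i = j then 1 else 0 := by
  unfold D
  have : fderiv ℝ (fun y : EuclideanSpace ℝ (Fin N) => y j) x = EuclideanSpace.proj (𝕜 := ℝ) j :=
    (EuclideanSpace.proj (𝕜 := ℝ) j).fderiv
  rw [this]
  simp [eq_comm]

lemma D_symm {f : EuclideanSpace ℝ (Fin N) → ℝ} (hf : ContDiff ℝ 2 f) (i j : Fin N)
    (x : EuclideanSpace ℝ (Fin N)) : D i (D j f) x = D j (D i f) x := by
  have hs : IsSymmSndFDerivAt ℝ f x :=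
    (hf.contDiffAt).isSymmSndFDerivAt (by simp)
  have hd : DifferentiableAt ℝ (fderiv ℝ f) x :=
    (hf.fderiv_right (m := 1) (by norm_num)).differentiable one_ne_zero x
  have key : ∀ k l : Fin N, D k (D l f) x =
      fderiv ℝ (fderiv ℝ f) x (EuclideanSpace.single k 1) (EuclideanSpace.single l 1) := by
    intro k l
    unfold D
    rw [fderiv_clm_apply hd (differentiableAt_const _)]
    simp
  rw [key, key]
  exact hs _ _

lemma hcs_D {f : EuclideanSpace ℝ (Fin N) → ℝ} (hf : HasCompactSupport f) (i : Fin N) :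
    HasCompactSupport (D i f) :=
  hf.fderiv_apply (𝕜 := ℝ) _

lemma int_D_zero {w : EuclideanSpace ℝ (Fin N) → ℝ} (hw : ContDiff ℝ 1 w)
    (hc : HasCompactSupport w) (i : Fin N) :
    Integrable (D i w) ∧ ∫ x, D i w x = 0 := by
  have h1 : Integrable (D i w) := (continuous_D hw i).integrable_of_hasCompactSupport (hcs_D hc i)
  refine ⟨h1, ?_⟩
  have := integral_mul_fderiv_eq_neg_fderiv_mul_of_integrable (𝕜 := ℝ)
    (μ := (volume : Measure (EuclideanSpace ℝ (Fin N))))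
    (f := fun _ => (1 : ℝ)) (g := w) (v := EuclideanSpace.single i 1) (by simp)
    (by simp only [one_mul]; exact h1)
    (by simpa using hw.continuous.integrable_of_hasCompactSupport hc)
    (fun x _ => differentiableAt_const _) (fun x _ => hw.differentiable one_ne_zero x)
  simpa [D] using this

lemma int_div_zero {w : Fin N → EuclideanSpace ℝ (Fin N) → ℝ} (hw : ∀ i, ContDiff ℝ 1 (w i))
    (hc : ∀ i, HasCompactSupport (w i)) :
    ∫ x, ∑ i, D i (w i) x = 0 := by
  rw [integral_finsetSum _ fun i _ => (int_D_zero (hw i) (hc i) i).1]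
  exact Finset.sum_eq_zero fun i _ => (int_D_zero (hw i) (hc i) i).2

/-- Energy identity with a cutoff, before inserting the equation. -/
lemma energy {u ψ : EuclideanSpace ℝ (Fin N) → ℝ} (hu : ContDiff ℝ 2 u) (hψ : ContDiff ℝ 1 ψ)
    (hc : HasCompactSupport ψ) :
    ∫ x, (ψ x ^ 2 * P u u x + 2 * (ψ x * u x * P u ψ x) + ψ x ^ 2 * u x * lap u x) = 0 := by
  have hu1 : ContDiff ℝ 1 u := hu.of_le (by norm_num)
  have h := int_div_zero (w := fun i x => ψ x * (ψ x * (u x * D i u x)))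
    (fun i => hψ.mul (hψ.mul (hu1.mul (contDiff_D hu i)))) (fun i => hc.mul_right)
  rw [← h]
  congr 1
  ext x
  have dψ := hψ.differentiable one_ne_zero x
  have du := hu1.differentiable one_ne_zero x
  have dD := fun i => (contDiff_D hu i).differentiable one_ne_zero x
  have : ∀ i, D i (fun x => ψ x * (ψ x * (u x * D i u x))) x =
      ψ x ^ 2 * (D i u x * D i u x) + 2 * (ψ x * u x * (D i u x * D i ψ x))
        + ψ x ^ 2 * u x * D i (D i u) x := by
    intro i
    rw [D_mul dψ (dψ.fun_mul (du.fun_mul (dD i))), D_mul dψ (du.fun_mul (dD i)), D_mul du (dD i)]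
    ring
  simp only [this, Finset.sum_add_distrib, ← Finset.mul_sum, lap_eq, P]

/-- The Pohozaev vector field identity with a cutoff, before inserting the equation. -/
lemma poho {u θ : EuclideanSpace ℝ (Fin N) → ℝ} (hu : ContDiff ℝ 2 u) (hθ : ContDiff ℝ 1 θ)
    (hc : HasCompactSupport θ) :
    ∫ x, (θ x * ((1 - (N : ℝ) / 2) * P u u x) + θ x * (fderiv ℝ u x x * lap u x)
      + (fderiv ℝ u x x * P u θ x - fderiv ℝ θ x x * P u u x / 2)) = 0 := by
  have hx : ∀ j, ContDiff ℝ 1 (fun y : EuclideanSpace ℝ (Fin N) => y j) :=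
    fun j => contDiff_coord j 1
  have hD := contDiff_D hu
  have hS : ContDiff ℝ 1 (fun x => ∑ j, x j * D j u x) :=
    ContDiff.sum fun j _ => (hx j).mul (hD j)
  have hQ : ContDiff ℝ 1 (fun x => ∑ j, D j u x * D j u x) :=
    ContDiff.sum fun j _ => (hD j).mul (hD j)
  have h := int_div_zero (w := fun i x => θ x * ((∑ j, x j * D j u x) * D i u x
      - (1 / 2) * (x i * ∑ j, D j u x * D j u x)))
    (fun i => hθ.mul ((hS.mul (hD i)).sub (contDiff_const.mul ((hx i).mul hQ))))
    (fun i => hc.mul_right)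
  rw [← h]
  congr 1
  ext x
  have e : (1 : WithTop ℕ∞) ≠ 0 := one_ne_zero
  have dθ := hθ.differentiable e x
  have dx := fun i => (hx i).differentiable e x
  have dD := fun i => (hD i).differentiable e x
  have dS := hS.differentiable e x
  have dQ := hQ.differentiable e x
  have eS : ∀ i, D i (fun x => ∑ j, x j * D j u x) x
      = D i u x + ∑ j, x j * D i (D j u) x := by
    intro i
    rw [D_sum (fun j => (dx j).fun_mul (dD j))]
    simp [D_mul (dx _) (dD _), D_coord, Finset.sum_add_distrib]
  have eQ : ∀ i, D i (fun x => ∑ j, D j u x * D j u x) x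
      = 2 * ∑ j, D j u x * D i (D j u) x := by
    intro i
    rw [D_sum (fun j => (dD j).fun_mul (dD j)), Finset.mul_sum]
    refine Finset.sum_congr rfl fun j _ => ?_
    rw [D_mul (dD j) (dD j)]; ring
  have : ∀ i, D i (fun x => θ x * ((∑ j, x j * D j u x) * D i u x
      - (1 / 2) * (x i * ∑ j, D j u x * D j u x))) x =
      ((∑ j, x j * D j u x) * (D i u x * D i θ x)
        - (x i * D i θ x) * ((∑ j, D j u x * D j u x) / 2)) + θ x * (
        D i u x * D i u x + (∑ j, x j * D i (D j u) x * D i u x)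
         + (∑ j, x j * D j u x) * D i (D i u) x - 
         (∑ j, D j u x * D j u x) / 2 - ∑ j, x i * D j u x * D i (D j u) x) := by
    intro i
    rw [D_mul dθ ((dS.fun_mul (dD i)).fun_sub ((differentiableAt_const _).fun_mul ((dx i).fun_mul dQ))),
      D_sub (dS.fun_mul (dD i)) ((differentiableAt_const _).fun_mul ((dx i).fun_mul dQ)),
      D_mul dS (dD i), D_const_mul ((dx i).fun_mul dQ), D_mul (dx i) dQ, eS, eQ, D_coord]
    have r1 : (∑ j, x j * D i (D j u) x * D i u x) = (∑ j, x j * D i (D j u) x) * D i u x := by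
      rw [Finset.sum_mul]
    have r2 : (∑ j, x i * D j u x * D i (D j u) x) = x i * ∑ j, D j u x * D i (D j u) x := by
      rw [Finset.mul_sum]; simp [mul_assoc]
    rw [r1, r2]
    simp only [if_true]
    ring
  simp only [this]
  have sw : ∑ i, ∑ j, x j * D i (D j u) x * D i u x
      = ∑ i, ∑ j, x i * D j u x * D i (D j u) x := by
    rw [Finset.sum_comm]
    refine Finset.sum_congr rfl fun i _ => Finset.sum_congr rfl fun j _ => ?_
    rw [D_symm hu i j]; ring
  rw [Finset.sum_add_distrib, ← Finset.mul_sum]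
  simp only [Finset.sum_add_distrib, Finset.sum_sub_distrib]
  rw [sw]
  simp only [← Finset.mul_sum, ← Finset.sum_mul, Finset.sum_const, Finset.card_univ, Fintype.card_fin, nsmul_eq_mul,
    fderiv_eq_sum u x x, fderiv_eq_sum θ x x, lap_eq, P]
  ring

lemma weight_diff {a : ℝ} (ha : 0 < a) (i : Fin N) (x : EuclideanSpace ℝ (Fin N)) :
    DifferentiableAt ℝ (fun y : EuclideanSpace ℝ (Fin N) => ‖y‖ ^ a * y i) x ∧
    D i (fun y : EuclideanSpace ℝ (Fin N) => ‖y‖ ^ a * y i) x =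
      ‖x‖ ^ a + a * (‖x‖ ^ (a - 2) * x i ^ 2) := by
  by_cases hx : x = 0
  · subst hx
    have h : HasFDerivAt (fun y : EuclideanSpace ℝ (Fin N) => ‖y‖ ^ a * y i)
        (0 : EuclideanSpace ℝ (Fin N) →L[ℝ] ℝ) 0 := by
      rw [hasFDerivAt_iff_isLittleO_nhds_zero]
      simp only [zero_add, norm_zero, Real.zero_rpow ha.ne', zero_mul, sub_zero,
        _root_.zero_apply, PiLp.zero_apply]
      have h1 : (fun y : EuclideanSpace ℝ (Fin N) => ‖y‖ ^ a) =o[𝓝 0] (fun _ => (1 : ℝ)) := by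
        rw [Asymptotics.isLittleO_one_iff]
        have : Continuous (fun y : EuclideanSpace ℝ (Fin N) => ‖y‖ ^ a) :=
          continuous_norm.rpow_const (fun _ => Or.inr ha.le)
        have h2 := this.tendsto 0
        simpa [Real.zero_rpow ha.ne'] using h2
      have h3 : (fun y : EuclideanSpace ℝ (Fin N) => y i) =O[𝓝 0] (fun y => y) :=
        Asymptotics.IsBigO.of_bound 1 (Eventually.of_forall fun y => by
          simpa using PiLp.norm_apply_le y i)
      have h4 := h1.mul_isBigO h3.norm_right
      simp only [one_mul] at h4
      exact h4.of_norm_right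
    refine ⟨h.differentiableAt, ?_⟩
    unfold D
    rw [h.fderiv]
    simp [Real.zero_rpow ha.ne']
  · have hn : 0 < ‖x‖ := norm_pos_iff.2 hx
    have e : (fun y : EuclideanSpace ℝ (Fin N) => ‖y‖ ^ a) = fun y => (‖y‖ ^ 2) ^ (a / 2) := by
      ext y
      rw [← Real.rpow_natCast_mul (norm_nonneg _)]
      congr 1
      push_cast; ring
    have h1 : HasFDerivAt (fun y : EuclideanSpace ℝ (Fin N) => ‖y‖ ^ 2) (2 • innerSL ℝ x) x :=
      (hasStrictFDerivAt_norm_sq x).hasFDerivAt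
    have h2 := h1.rpow_const (p := a / 2) (Or.inl (by positivity))
    rw [← e] at h2
    have h3 : DifferentiableAt ℝ (fun y : EuclideanSpace ℝ (Fin N) => y i) x :=
      (contDiff_coord i 1).differentiable one_ne_zero x
    refine ⟨h2.differentiableAt.fun_mul h3, ?_⟩
    rw [D_mul h2.differentiableAt h3, D_coord]
    unfold D
    rw [h2.fderiv]
    have e2 : (‖x‖ ^ 2) ^ (a / 2 - 1) = ‖x‖ ^ (a - 2) := by
      rw [← Real.rpow_natCast_mul (norm_nonneg _)]
      congr 1
      push_cast; ring
    rw [e2]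
    simp [EuclideanSpace.inner_single_right]
    ring

lemma continuous_weight {a : ℝ} (ha : 0 ≤ a) :
    Continuous (fun x : EuclideanSpace ℝ (Fin N) => ‖x‖ ^ a) :=
  continuous_norm.rpow_const (fun _ => Or.inr ha)

lemma weight_cont {a : ℝ} (ha : 0 < a) (i : Fin N) :
    Continuous (fun x : EuclideanSpace ℝ (Fin N) => ‖x‖ ^ (a - 2) * x i ^ 2) := by
  rw [continuous_iff_continuousAt]
  intro x
  have hc : Continuous (fun y : EuclideanSpace ℝ (Fin N) => y i) :=
    (contDiff_coord i 1).continuous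
  by_cases hx : x = 0
  · subst hx
    have h2 := (continuous_weight (N := N) ha.le).tendsto 0
    simp only [norm_zero, Real.zero_rpow ha.ne'] at h2
    have : ContinuousAt (fun x : EuclideanSpace ℝ (Fin N) => ‖x‖ ^ (a - 2) * x i ^ 2) 0 ↔
        Tendsto (fun x : EuclideanSpace ℝ (Fin N) => ‖x‖ ^ (a - 2) * x i ^ 2) (𝓝 0) (𝓝 0) := by
      simp [ContinuousAt]
    rw [this]
    refine squeeze_zero (fun y => by positivity) (fun y => ?_) h2
    by_cases hy : y = 0
    · subst hy; simp [Real.zero_rpow ha.ne']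
    have hn : 0 < ‖y‖ := norm_pos_iff.2 hy
    calc ‖y‖ ^ (a - 2) * y i ^ 2 ≤ ‖y‖ ^ (a - 2) * ‖y‖ ^ 2 := by
          refine mul_le_mul_of_nonneg_left ?_ (by positivity)
          have := PiLp.norm_apply_le y i
          rw [Real.norm_eq_abs] at this
          exact sq_le_sq' (by linarith [neg_abs_le (y i)]) ((le_abs_self _).trans this)
      _ = ‖y‖ ^ a := by
          rw [← Real.rpow_natCast, ← Real.rpow_add hn]; congr 1; push_cast; ring
  · exact (continuous_norm.continuousAt.rpow_const (Or.inl (by simpa using hx))).mul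
      (hc.continuousAt.pow 2)

lemma weight_int {a : ℝ} (ha : 0 ≤ a) {g : EuclideanSpace ℝ (Fin N) → ℝ} (hg : ContDiff ℝ 1 g)
    (hc : HasCompactSupport g) :
    ∫ x, (((N : ℝ) + a) * (‖x‖ ^ a * g x) + ‖x‖ ^ a * fderiv ℝ g x x) = 0 := by
  have hw := continuous_weight (N := N) ha
  have hx : ∀ i, Continuous (fun y : EuclideanSpace ℝ (Fin N) => y i) :=
    fun i => (contDiff_coord i 1).continuous
  have key : ∀ i : Fin N, ∃ T : EuclideanSpace ℝ (Fin N) → ℝ, Continuous T ∧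
      (∀ x, DifferentiableAt ℝ (fun y : EuclideanSpace ℝ (Fin N) => ‖y‖ ^ a * y i) x) ∧ 
      (∀ x, D i (fun y : EuclideanSpace ℝ (Fin N) => ‖y‖ ^ a * y i) x = T x) ∧
      T = fun x => ‖x‖ ^ a + a * (‖x‖ ^ (a - 2) * x i ^ 2) := by
    intro i
    rcases ha.eq_or_lt with h0 | h0
    · subst h0
      refine ⟨_, ?_, ?_, ?_, rfl⟩
      · simp only [Real.rpow_zero, zero_mul, add_zero]; exact continuous_const
      · intro x
        simp only [Real.rpow_zero, one_mul]
        exact (contDiff_coord i 1).differentiable one_ne_zero x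
      · intro x
        simp [D_coord]
    · exact ⟨_, hw.add (continuous_const.mul (weight_cont h0 i)), fun x => (weight_diff h0 i x).1,
        fun x => (weight_diff h0 i x).2, rfl⟩
  have each : ∀ i : Fin N,
      Integrable (fun x => (‖x‖ ^ a + a * (‖x‖ ^ (a - 2) * x i ^ 2)) * g x
        + ‖x‖ ^ a * x i * D i g x) ∧
      ∫ x, ((‖x‖ ^ a + a * (‖x‖ ^ (a - 2) * x i ^ 2)) * g x + ‖x‖ ^ a * x i * D i g x) = 0 := by
    intro i
    obtain ⟨T, hT, hd, hD, e⟩ := key i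
    have i1 : Integrable (fun x => T x * g x) :=
      (hT.mul hg.continuous).integrable_of_hasCompactSupport hc.mul_left
    have i2 : Integrable (fun x => ‖x‖ ^ a * x i * D i g x) :=
      ((hw.mul (hx i)).mul (continuous_D hg i)).integrable_of_hasCompactSupport
        (hcs_D hc i).mul_left
    have i3 : Integrable (fun x => ‖x‖ ^ a * x i * g x) :=
      ((hw.mul (hx i)).mul hg.continuous).integrable_of_hasCompactSupport hc.mul_left
    have h := integral_mul_fderiv_eq_neg_fderiv_mul_of_integrable (𝕜 := ℝ)
      (μ := (volume : Measure (EuclideanSpace ℝ (Fin N))))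
      (f := fun x => ‖x‖ ^ a * x i) (g := g) (v := EuclideanSpace.single i 1)
      (i1.congr (Eventually.of_forall fun x => by simp only [← hD]; rfl)) i2 i3
      (fun x _ => hd x) (fun x _ => hg.differentiable one_ne_zero x)
    have h' : ∫ x, ‖x‖ ^ a * x i * D i g x = -∫ x, T x * g x := by
      refine h.trans ?_
      congr 1
      refine integral_congr_ae (Eventually.of_forall fun x => ?_)
      simp only [← hD]; rfl
    rw [e] at i1 h'
    refine ⟨i1.add i2, ?_⟩
    rw [integral_add i1 i2, h']
    ring
  have hs := integral_finsetSum (Finset.univ : Finset (Fin N)) (fun i _ => (each i).1)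
  rw [Finset.sum_eq_zero (fun i _ => (each i).2)] at hs
  rw [← hs]
  congr 1
  ext x
  rw [Finset.sum_add_distrib, ← Finset.sum_mul, Finset.sum_add_distrib, ← Finset.mul_sum,
    ← Finset.mul_sum, fderiv_eq_sum, ← EuclideanSpace.real_norm_sq_eq]
  have e3 : a * (‖x‖ ^ (a - 2) * ‖x‖ ^ 2) = a * ‖x‖ ^ a := by
    rcases ha.eq_or_lt with h0 | h0
    · simp [← h0]
    by_cases hy : x = 0
    · subst hy; simp [Real.zero_rpow h0.ne']
    have hn : 0 < ‖x‖ := norm_pos_iff.2 hy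
    rw [← Real.rpow_natCast, ← Real.rpow_add hn]; congr 2; push_cast; ring
  rw [e3, Finset.mul_sum]
  simp only [Finset.sum_const, Finset.card_univ, Fintype.card_fin, nsmul_eq_mul, mul_assoc]
  ring

lemma exists_cutoff (N : ℕ) : ∃ M : ℝ, 0 < M ∧ ∃ η : ℝ → EuclideanSpace ℝ (Fin N) → ℝ, ∀ R, 0 < R →
    ContDiff ℝ 2 (η R) ∧ HasCompactSupport (η R) ∧ (∀ x, 0 ≤ η R x) ∧ (∀ x, η R x ≤ 1) ∧
    (∀ x, ‖x‖ ≤ R → η R x = 1) ∧ (∀ x, 2 * R ≤ ‖x‖ → η R x = 0) ∧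
    (∀ x, ‖fderiv ℝ (η R) x‖ ≤ M / R) ∧ (∀ x, ‖x‖ < R → fderiv ℝ (η R) x = 0) ∧
    (∀ x, 2 * R < ‖x‖ → fderiv ℝ (η R) x = 0) := by
  let f : ContDiffBump (0 : EuclideanSpace ℝ (Fin N)) := ⟨1, 2, one_pos, one_lt_two⟩
  have hf : ContDiff ℝ 2 f := f.contDiff
  have hc : HasCompactSupport f := f.hasCompactSupport
  obtain ⟨M, hM⟩ := (hc.fderiv (𝕜 := ℝ)).exists_bound_of_continuous
    (hf.continuous_fderiv two_ne_zero)
  have hM0 : 0 ≤ M := (norm_nonneg _).trans (hM 0)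
  refine ⟨M + 1, by linarith, fun R x => f (R⁻¹ • x), fun R hR => ?_⟩
  have hRn : ∀ x : EuclideanSpace ℝ (Fin N), ‖R⁻¹ • x‖ = ‖x‖ / R := fun x => by
    rw [norm_smul, norm_inv, Real.norm_of_nonneg hR.le]; field_simp
  have h1 : ∀ x : EuclideanSpace ℝ (Fin N), ‖x‖ ≤ R → f (R⁻¹ • x) = 1 := fun x hx =>
    f.one_of_mem_closedBall (by
      rw [mem_closedBall_zero_iff, hRn]; exact (div_le_one hR).2 hx)
  have h0 : ∀ x : EuclideanSpace ℝ (Fin N), 2 * R ≤ ‖x‖ → f (R⁻¹ • x) = 0 := fun x hx =>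
    f.zero_of_le_dist (by rw [dist_zero_right, hRn]; exact (le_div_iff₀ hR).2 hx)
  refine ⟨hf.comp (contDiff_const_smul _), ?_, fun x => f.nonneg, fun x => f.le_one, h1, h0, ?_, ?_, ?_⟩
  · exact HasCompactSupport.of_support_subset_isCompact (isCompact_closedBall 0 (2 * R)) (by
      intro x hx
      rw [mem_closedBall_zero_iff]
      by_contra h
      exact hx (h0 x (not_le.1 h).le))
  · intro x
    have hd : HasFDerivAt (fun x => f (R⁻¹ • x)) ((fderiv ℝ f (R⁻¹ • x)).comp
        (R⁻¹ • ContinuousLinearMap.id ℝ (EuclideanSpace ℝ (Fin N)))) x :=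
      HasFDerivAt.comp (g := f) x (hf.differentiable two_ne_zero _).hasFDerivAt
        ((hasFDerivAt_id x).const_smul R⁻¹)
    rw [hd.fderiv, ContinuousLinearMap.comp_smul, ContinuousLinearMap.comp_id, norm_smul, norm_inv,
      Real.norm_of_nonneg hR.le, inv_mul_eq_div]
    gcongr
    linarith [hM (R⁻¹ • x)]
  · intro x hx
    have : (fun x => f (R⁻¹ • x)) =ᶠ[𝓝 x] fun _ => (1 : ℝ) := by
      filter_upwards [(isOpen_lt continuous_norm continuous_const).mem_nhds hx] with y hy
      exact h1 y (le_of_lt hy)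
    rw [this.fderiv_eq]; simp
  · intro x hx
    have : (fun x => f (R⁻¹ • x)) =ᶠ[𝓝 x] fun _ => (0 : ℝ) := by
      filter_upwards [(isOpen_lt continuous_const continuous_norm).mem_nhds hx] with y hy
      exact h0 y (le_of_lt hy)
    rw [this.fderiv_eq]; simp

lemma exists_cutoff' (N : ℕ) {p : ℝ} (hp : 1 < p) :
    ∃ C : ℝ, 0 < C ∧ ∃ θ : ℝ → EuclideanSpace ℝ (Fin N) → ℝ, ∀ R, 0 < R →
    ContDiff ℝ 2 (θ R) ∧ HasCompactSupport (θ R) ∧ (∀ x, 0 ≤ θ R x) ∧ (∀ x, θ R x ≤ 1) ∧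
    (∀ x, ‖x‖ ≤ R → θ R x = 1) ∧ (∀ x, 2 * R ≤ ‖x‖ → θ R x = 0) ∧
    (∀ x, ‖fderiv ℝ (θ R) x‖ ≤ C / R) ∧ (∀ x, ‖x‖ < R → fderiv ℝ (θ R) x = 0) ∧
    (∀ x, 2 * R < ‖x‖ → fderiv ℝ (θ R) x = 0) ∧
    (∀ x, ‖fderiv ℝ (θ R) x‖ ^ 2 ≤ C / R ^ 2 * (θ R x) ^ (4 / (p + 1))) := by
  obtain ⟨M, hM, η, hη⟩ := exists_cutoff N
  obtain ⟨m, hm⟩ := exists_nat_ge ((p + 1) / (p - 1))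
  have hp1 : 0 < p - 1 := by linarith
  have hm2 : p + 1 ≤ m * (p - 1) := (div_le_iff₀ hp1).1 hm
  have hm1 : 1 ≤ m := by
    rcases Nat.eq_zero_or_pos m with h | h
    · subst h; simp at hm2; linarith
    · exact h
  refine ⟨(m * M) ^ 2 + m * M, by positivity, fun R x => η R x ^ m, fun R hR => ?_⟩
  obtain ⟨h1, h2, h3, h4, h5, h6, h7, h8, h9⟩ := hη R hR
  have hd : ∀ x, fderiv ℝ (fun x => η R x ^ m) x = (m * η R x ^ (m - 1)) • fderiv ℝ (η R) x := by
    intro x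
    rw [fderiv_fun_pow (n := m) (h1.differentiable two_ne_zero x)]
    simp [mul_smul]
  have hn : ∀ x, ‖fderiv ℝ (fun x => η R x ^ m) x‖ ≤ (m * M / R) * η R x ^ (m - 1) := by
    intro x
    rw [hd, norm_smul, norm_mul, norm_pow, Real.norm_of_nonneg (h3 x)]
    simp only [Real.norm_natCast]
    calc (m : ℝ) * η R x ^ (m - 1) * ‖fderiv ℝ (η R) x‖ ≤ m * η R x ^ (m - 1) * (M / R) := by
          have := h3 x
          gcongr
          exact h7 x
      _ = _ := by ring
  refine ⟨h1.pow m, ?_, fun x => pow_nonneg (h3 x) m, fun x => pow_le_one₀ (h3 x) (h4 x), ?_, ?_,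
    ?_, ?_, ?_, ?_⟩
  · obtain ⟨k, rfl⟩ : ∃ k, m = k + 1 := ⟨m - 1, by omega⟩
    simp only [pow_succ]
    exact h2.mul_left
  · intro x hx; simp [h5 x hx]
  · intro x hx; simp only [h6 x hx]; exact zero_pow (by omega)
  · intro x
    calc _ ≤ (m * M / R) * η R x ^ (m - 1) := hn x
      _ ≤ (m * M / R) * 1 := by
        gcongr
        exact pow_le_one₀ (h3 x) (h4 x)
      _ ≤ _ := by
        rw [mul_one]; gcongr; nlinarith [sq_nonneg (m * M)]
  · intro x hx; rw [hd, h8 x hx, smul_zero]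
  · intro x hx; rw [hd, h9 x hx, smul_zero]
  · intro x
    have e : (η R x ^ (m - 1)) ^ 2 ≤ (η R x ^ m) ^ (4 / (p + 1)) := by
      rw [← pow_mul, ← Real.rpow_natCast, ← Real.rpow_natCast_mul (h3 x)]
      refine Real.rpow_le_rpow_of_exponent_ge' (h3 x) (h4 x) (by positivity) ?_
      rw [mul_div_assoc', div_le_iff₀ (by linarith)]
      push_cast [Nat.cast_sub hm1]
      linarith
    calc _ ≤ ((m * M / R) * η R x ^ (m - 1)) ^ 2 := by gcongr; exact hn x
      _ = (m * M) ^ 2 / R ^ 2 * (η R x ^ (m - 1)) ^ 2 := by ring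
      _ ≤ ((m * M) ^ 2 + m * M) / R ^ 2 * (η R x ^ m) ^ (4 / (p + 1)) := by
        have : 0 ≤ m * M := by positivity
        gcongr
        linarith

/-- The error constant in the pointwise Young type inequality. -/
noncomputable def cR (C ε a p R : ℝ) : ℝ := C / R ^ 2 * (C / (ε * (R ^ 2 * R ^ a))) ^ (2 / (p - 1))

lemma young {C ε a p R r v t G : ℝ} (hC : 0 < C) (hε : 0 < ε) (ha : 0 ≤ a) (hp : 1 < p)
    (hR : 0 < R) (hr : R ≤ r) (hv : 0 < v) (ht : 0 ≤ t)
    (hG : G ≤ C / R ^ 2 * t ^ (4 / (p + 1))) :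
    v ^ 2 * G ≤ ε * (t ^ 2 * (r ^ a * v ^ (p + 1))) + cR C ε a p R := by
  have hp1 : 0 < p - 1 := by linarith
  have hp2 : 0 < p + 1 := by linarith
  set s := v * t ^ (2 / (p + 1)) with hs
  have hs0 : 0 ≤ s := by positivity
  have hs2 : s ^ 2 = v ^ 2 * t ^ (4 / (p + 1)) := by
    rw [hs, mul_pow, ← Real.rpow_mul_natCast ht]
    congr 2
    push_cast; ring
  have hsp : s ^ (p + 1) = v ^ (p + 1) * t ^ 2 := by
    rw [hs, Real.mul_rpow hv.le (by positivity), ← Real.rpow_mul ht,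
      div_mul_cancel₀ _ hp2.ne', Real.rpow_two]
  have hRa : 0 < R ^ a := by positivity
  have hra : R ^ a ≤ r ^ a := Real.rpow_le_rpow hR.le hr ha
  have hr0 : 0 < r := hR.trans_le hr
  have h1 : v ^ 2 * G ≤ C / R ^ 2 * s ^ 2 := by
    rw [hs2]
    calc v ^ 2 * G ≤ v ^ 2 * (C / R ^ 2 * t ^ (4 / (p + 1))) := by gcongr
      _ = _ := by ring
  refine h1.trans ?_
  set B := C / (ε * (R ^ 2 * R ^ a)) with hB
  have hB0 : 0 < B := by positivity
  have hc0 : 0 ≤ cR C ε a p R := by unfold cR; positivity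
  by_cases h : s ^ (p - 1) ≤ B
  · have : s ^ 2 ≤ B ^ (2 / (p - 1)) := by
      calc s ^ 2 = (s ^ (p - 1)) ^ (2 / (p - 1)) := by
            rw [← Real.rpow_mul hs0, mul_div_cancel₀ _ hp1.ne', Real.rpow_two]
        _ ≤ _ := by gcongr
    have h2 : C / R ^ 2 * s ^ 2 ≤ cR C ε a p R := by
      unfold cR; gcongr
    have : 0 ≤ ε * (t ^ 2 * (r ^ a * v ^ (p + 1))) := by positivity
    linarith
  · push Not at h
    have e1 : s ^ (p + 1) = s ^ 2 * s ^ (p - 1) := by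
      rw [← Real.rpow_two, ← Real.rpow_add' hs0 (by linarith)]; congr 1; ring
    have : C / R ^ 2 * s ^ 2 ≤ ε * (t ^ 2 * (r ^ a * v ^ (p + 1))) := by
      calc C / R ^ 2 * s ^ 2 = ε * (R ^ a * (s ^ 2 * B)) := by
            rw [hB]; field_simp
        _ ≤ ε * (r ^ a * (s ^ 2 * s ^ (p - 1))) := by gcongr
        _ = _ := by rw [← e1, hsp]; ring
    linarith

lemma cR_tendsto {C ε a p : ℝ} (hN : 3 ≤ N) (hC : 0 < C) (hε : 0 < ε) (hp : 1 < p)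
    (hsub : p < ((N : ℝ) + 2 + 2 * a) / ((N : ℝ) - 2)) :
    Tendsto (fun R => cR C ε a p R *
      (volume : Measure (EuclideanSpace ℝ (Fin N))).real (closedBall 0 (2 * R))) atTop (𝓝 0) := by
  have hN' : (3 : ℝ) ≤ N := by exact_mod_cast hN
  have hp1 : 0 < p - 1 := by linarith
  have hs : p * ((N : ℝ) - 2) < (N : ℝ) + 2 + 2 * a := (lt_div_iff₀ (by linarith)).1 hsub
  set κ : ℝ := (2 + a) * (2 / (p - 1)) + 2 - N with hκ
  have hκ0 : 0 < κ := by
    have : κ = (2 * (2 + a) + (2 - N) * (p - 1)) / (p - 1) := by rw [hκ]; field_simp; ring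
    rw [this]
    apply div_pos _ hp1
    linarith
  set V := (volume : Measure (EuclideanSpace ℝ (Fin N))).real (ball 0 1) with hV
  have ht := (tendsto_rpow_neg_atTop hκ0).const_mul (C * (C / ε) ^ (2 / (p - 1)) * (2 ^ N * V))
  rw [mul_zero] at ht
  refine ht.congr' ?_
  filter_upwards [eventually_gt_atTop 0] with R hR
  rw [Measure.real, Measure.addHaar_closedBall _ _ (by positivity), finrank_euclideanSpace_fin,
    ENNReal.toReal_mul, ENNReal.toReal_ofReal (by positivity)]
  change _ = _ * (_ * V)
  unfold cR
  have e1 : C / (ε * (R ^ 2 * R ^ a)) = (C / ε) * (R ^ (2 + a))⁻¹ := by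
    rw [Real.rpow_add hR, Real.rpow_two]; field_simp
  rw [e1, Real.mul_rpow (by positivity) (by positivity), ← Real.rpow_neg hR.le,
    ← Real.rpow_mul hR.le]
  have e2 : R ^ (-κ) = (R ^ 2)⁻¹ * R ^ (-(2 + a) * (2 / (p - 1))) * R ^ N := by
    rw [← Real.rpow_natCast R N, ← Real.rpow_two, ← Real.rpow_neg hR.le, ← Real.rpow_add hR,
      ← Real.rpow_add hR]
    congr 1
    rw [hκ]; ring
  rw [e2]
  ring

lemma P_nonneg (f : EuclideanSpace ℝ (Fin N) → ℝ) (x : EuclideanSpace ℝ (Fin N)) :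
    0 ≤ P f f x := by rw [P_eq_norm]; positivity

lemma P_sq_le (f g : EuclideanSpace ℝ (Fin N) → ℝ) (x : EuclideanSpace ℝ (Fin N)) :
    P f g x ^ 2 ≤ P f f x * P g g x := by
  simpa [P, sq] using Finset.sum_mul_sq_le_sq_mul_sq Finset.univ
    (fun i => D i f x) (fun i => D i g x)

lemma P_mul {f g : EuclideanSpace ℝ (Fin N) → ℝ} {x : EuclideanSpace ℝ (Fin N)}
    (hf : DifferentiableAt ℝ f x) (hg : DifferentiableAt ℝ g x) :
    P (fun y => f y * g y) (fun y => f y * g y) x =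
      g x ^ 2 * P f f x + 2 * (g x * f x * P f g x) + f x ^ 2 * P g g x := by
  simp only [P, Finset.mul_sum, ← Finset.sum_add_distrib, D_mul hf hg]
  refine Finset.sum_congr rfl fun i _ => ?_
  ring

lemma P_mul_le {f g : EuclideanSpace ℝ (Fin N) → ℝ} {x : EuclideanSpace ℝ (Fin N)}
    (hf : DifferentiableAt ℝ f x) (hg : DifferentiableAt ℝ g x) :
    P (fun y => f y * g y) (fun y => f y * g y) x ≤
      2 * (g x ^ 2 * P f f x) + 2 * (f x ^ 2 * P g g x) := by
  simp only [P, Finset.mul_sum, ← Finset.sum_add_distrib, D_mul hf hg]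
  refine Finset.sum_le_sum fun i _ => ?_
  nlinarith [sq_nonneg (D i f x * g x - f x * D i g x)]

lemma cross_le {f g : EuclideanSpace ℝ (Fin N) → ℝ} {x : EuclideanSpace ℝ (Fin N)} (b c : ℝ) :
    |2 * (b * c * P f g x)| ≤ b ^ 2 * P f f x + c ^ 2 * P g g x := by
  rw [abs_le]
  simp only [P, Finset.mul_sum, ← Finset.sum_add_distrib, ← Finset.sum_neg_distrib]
  constructor
  · refine Finset.sum_le_sum fun i _ => ?_
    nlinarith [sq_nonneg (b * D i f x + c * D i g x)]
  · refine Finset.sum_le_sum fun i _ => ?_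
    nlinarith [sq_nonneg (b * D i f x - c * D i g x)]

lemma cross_le' {f g : EuclideanSpace ℝ (Fin N) → ℝ} {x : EuclideanSpace ℝ (Fin N)} (b c : ℝ) :
    -(b ^ 2 * P f f x / 2 + 2 * (c ^ 2 * P g g x)) ≤ 2 * (b * c * P f g x) := by
  have := (abs_le.1 (cross_le (f := f) (g := g) (x := x) (b / 2) c)).1
  nlinarith [sq_nonneg b, P_nonneg f x]

lemma tail_tendsto {f : EuclideanSpace ℝ (Fin N) → ℝ} (hf : Integrable f) :
    Tendsto (fun R : ℝ => ∫ x, ({x | R ≤ ‖x‖} : Set (EuclideanSpace ℝ (Fin N))).indicator f x)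
      atTop (𝓝 0) := by
  have hm : ∀ R : ℝ, MeasurableSet {x : EuclideanSpace ℝ (Fin N) | R ≤ ‖x‖} := fun R =>
    (isClosed_le continuous_const continuous_norm).measurableSet
  have := tendsto_integral_filter_of_dominated_convergence
    (F := fun (R : ℝ) x => ({x | R ≤ ‖x‖} : Set (EuclideanSpace ℝ (Fin N))).indicator f x)
    (f := fun _ => (0 : ℝ)) (μ := (volume : Measure (EuclideanSpace ℝ (Fin N)))) (l := atTop)
    (fun x => ‖f x‖) (Eventually.of_forall fun R => (hf.indicator (hm R)).aestronglyMeasurable)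
    (Eventually.of_forall fun R => Eventually.of_forall fun x => norm_indicator_le_norm_self f x)
    hf.norm (Eventually.of_forall fun x => by
      refine tendsto_const_nhds.congr' ?_
      filter_upwards [eventually_gt_atTop ‖x‖] with R hR
      rw [Set.indicator_of_notMem]
      simpa using hR)
  simpa using this

lemma mass_tendsto {f : EuclideanSpace ℝ (Fin N) → ℝ} (hf : Integrable f)
    {θ : ℝ → EuclideanSpace ℝ (Fin N) → ℝ} (hθc : ∀ R, 0 < R → Continuous (θ R))
    (h0 : ∀ R, 0 < R → ∀ x, 0 ≤ θ R x) (h1 : ∀ R, 0 < R → ∀ x, θ R x ≤ 1)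
    (h2 : ∀ R, 0 < R → ∀ x, ‖x‖ ≤ R → θ R x = 1) :
    Tendsto (fun R : ℝ => ∫ x, θ R x * f x) atTop (𝓝 (∫ x, f x)) := by
  refine tendsto_integral_filter_of_dominated_convergence (fun x => ‖f x‖) ?_ ?_ hf.norm ?_
  · filter_upwards [eventually_gt_atTop 0] with R hR
    exact (hθc R hR).aestronglyMeasurable.mul hf.aestronglyMeasurable
  · filter_upwards [eventually_gt_atTop 0] with R hR
    refine Eventually.of_forall fun x => ?_
    rw [norm_mul, Real.norm_of_nonneg (h0 R hR x)]
    exact mul_le_of_le_one_left (norm_nonneg _) (h1 R hR x)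
  · refine Eventually.of_forall fun x => ?_
    refine tendsto_const_nhds.congr' ?_
    filter_upwards [eventually_gt_atTop 0, eventually_ge_atTop ‖x‖] with R hR hx
    rw [h2 R hR x hx, one_mul]

lemma integrable_of_cutoff_bound {f : EuclideanSpace ℝ (Fin N) → ℝ} (hf : Continuous f)
    (h0 : ∀ x, 0 ≤ f x) {I : ℝ} (h : ∀ᶠ R : ℝ in atTop, ∫ x in ball 0 R, f x ≤ I) :
    Integrable f := by
  refine (aecover_ball (x := (0 : EuclideanSpace ℝ (Fin N)))
    (tendsto_id (α := ℝ) (x := atTop))).integrable_of_integral_bounded_of_nonneg_ae I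
    (fun R => ?_) (Eventually.of_forall h0) h
  exact (hf.continuousOn.integrableOn_compact (isCompact_closedBall 0 R)).mono_set
    ball_subset_closedBall

lemma setInt_le {f g : EuclideanSpace ℝ (Fin N) → ℝ} {R : ℝ} (hf : Continuous f)
    (hg : Integrable g) (hg0 : ∀ x, 0 ≤ g x) (h : ∀ x, ‖x‖ < R → f x ≤ g x) :
    ∫ x in ball 0 R, f x ≤ ∫ x, g x := by
  have hfi : IntegrableOn f (ball 0 R) :=
    (hf.continuousOn.integrableOn_compact (isCompact_closedBall 0 R)).mono_set
      ball_subset_closedBall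
  refine (setIntegral_mono_on hfi hg.integrableOn measurableSet_ball
    (fun x hx => h x (by simpa using hx))).trans ?_
  exact setIntegral_le_integral hg (Eventually.of_forall hg0)

section main

variable {a p : ℝ} {u : EuclideanSpace ℝ (Fin N) → ℝ}

lemma continuous_F (ha : 0 ≤ a) (hu : ContDiff ℝ 2 u) (hupos : ∀ x, 0 < u x) (q : ℝ) :
    Continuous (fun x => ‖x‖ ^ a * u x ^ q) :=
  (continuous_weight ha).mul (hu.continuous.rpow_const fun x => Or.inl (hupos x).ne')

/-- Energy identity with cutoff for solutions. -/
lemma energy_sol (hu : ContDiff ℝ 2 u) (hupos : ∀ x, 0 < u x)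
    (hequ : ∀ x, -lap u x = ‖x‖ ^ a * u x ^ p) {ψ : EuclideanSpace ℝ (Fin N) → ℝ}
    (hψ : ContDiff ℝ 1 ψ) (hc : HasCompactSupport ψ) :
    ∫ x, (ψ x ^ 2 * P u u x + 2 * (ψ x * u x * P u ψ x)
      - ψ x ^ 2 * (‖x‖ ^ a * u x ^ (p + 1))) = 0 := by
  rw [← energy hu hψ hc]
  congr 1
  ext x
  have : lap u x = -(‖x‖ ^ a * u x ^ p) := by linarith [hequ x]
  rw [this, Real.rpow_add_one (hupos x).ne']
  ring

lemma hcs_sq {ψ : EuclideanSpace ℝ (Fin N) → ℝ} (hc : HasCompactSupport ψ) :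
    HasCompactSupport (fun x => ψ x ^ 2) := by
  simp only [sq]; exact hc.mul_left

lemma hcs_P {f g : EuclideanSpace ℝ (Fin N) → ℝ} (hc : HasCompactSupport g) :
    HasCompactSupport (P f g) := by
  refine (hc.fderiv (𝕜 := ℝ)).mono ?_
  intro x hx
  rw [Function.mem_support] at hx ⊢
  intro h
  exact hx (by simp [P, D, h])

/-- The stability inequality tested with `u ψ`. -/
lemma stab (ha : 0 ≤ a) (hu : ContDiff ℝ 2 u) (hupos : ∀ x, 0 < u x)
    (hequ : ∀ x, -lap u x = ‖x‖ ^ a * u x ^ p)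
    {K : Set (EuclideanSpace ℝ (Fin N))}
    (hstable : ∀ φ : EuclideanSpace ℝ (Fin N) → ℝ,
      ContDiff ℝ 1 φ → HasCompactSupport φ → Disjoint (tsupport φ) K →
      0 ≤ (∫ x, ‖gradient φ x‖ ^ 2) - p * ∫ x, ‖x‖ ^ a * u x ^ (p - 1) * φ x ^ 2)
    {ψ : EuclideanSpace ℝ (Fin N) → ℝ}
    (hψ : ContDiff ℝ 1 ψ) (hc : HasCompactSupport ψ) (hK : Disjoint (tsupport ψ) K) :
    (p - 1) * ∫ x, ψ x ^ 2 * (‖x‖ ^ a * u x ^ (p + 1)) ≤ ∫ x, u x ^ 2 * P ψ ψ x := by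
  have hu1 : ContDiff ℝ 1 u := hu.of_le (by norm_num)
  have h := hstable (fun x => u x * ψ x) (hu1.mul hψ) hc.mul_left
    (hK.mono_left (tsupport_mul_subset_right))
  have e1 : ∀ x, ‖x‖ ^ a * u x ^ (p - 1) * (u x * ψ x) ^ 2
      = ψ x ^ 2 * (‖x‖ ^ a * u x ^ (p + 1)) := by
    intro x
    have : u x ^ (p + 1) = u x ^ (p - 1) * u x ^ 2 := by
      rw [← Real.rpow_two, ← Real.rpow_add (hupos x)]; congr 1; ring
    rw [this]; ring
  have e2 : ∀ x, ‖gradient (fun x => u x * ψ x) x‖ ^ 2 =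
      (ψ x ^ 2 * P u u x + 2 * (ψ x * u x * P u ψ x) - ψ x ^ 2 * (‖x‖ ^ a * u x ^ (p + 1)))
      + ψ x ^ 2 * (‖x‖ ^ a * u x ^ (p + 1)) + u x ^ 2 * P ψ ψ x := by
    intro x
    rw [← P_eq_norm, P_mul (hu1.differentiable one_ne_zero x) (hψ.differentiable one_ne_zero x)]
    ring
  simp only [e1, e2] at h
  have hF := continuous_F ha hu hupos (p + 1)
  have i1 : Integrable (fun x => ψ x ^ 2 * P u u x) :=
    ((hψ.continuous.pow 2).mul (continuous_P hu1 hu1)).integrable_of_hasCompactSupport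
      (hcs_sq hc).mul_right
  have i2 : Integrable (fun x => 2 * (ψ x * u x * P u ψ x)) :=
    (((hψ.continuous.mul hu.continuous).mul
      (continuous_P hu1 hψ)).integrable_of_hasCompactSupport (hcs_P hc).mul_left).const_mul 2
  have i3 : Integrable (fun x => ψ x ^ 2 * (‖x‖ ^ a * u x ^ (p + 1))) :=
    ((hψ.continuous.pow 2).mul hF).integrable_of_hasCompactSupport (hcs_sq hc).mul_right
  have i4 : Integrable (fun x => u x ^ 2 * P ψ ψ x) :=
    ((hu.continuous.pow 2).mul (continuous_P hψ hψ)).integrable_of_hasCompactSupport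
      (hcs_P hc).mul_left
  have i5 : Integrable (fun x => ψ x ^ 2 * P u u x + 2 * (ψ x * u x * P u ψ x)
      - ψ x ^ 2 * (‖x‖ ^ a * u x ^ (p + 1))) := (i1.add i2).sub i3
  have i6 : Integrable (fun x => ψ x ^ 2 * P u u x + 2 * (ψ x * u x * P u ψ x)
      - ψ x ^ 2 * (‖x‖ ^ a * u x ^ (p + 1)) + ψ x ^ 2 * (‖x‖ ^ a * u x ^ (p + 1))) := i5.add i3
  rw [integral_add i6 i4] at h
  rw [show (∫ x, (ψ x ^ 2 * P u u x + 2 * (ψ x * u x * P u ψ x)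
      - ψ x ^ 2 * (‖x‖ ^ a * u x ^ (p + 1)) + ψ x ^ 2 * (‖x‖ ^ a * u x ^ (p + 1)))) =
      (∫ x, (ψ x ^ 2 * P u u x + 2 * (ψ x * u x * P u ψ x)
      - ψ x ^ 2 * (‖x‖ ^ a * u x ^ (p + 1)))) + ∫ x, ψ x ^ 2 * (‖x‖ ^ a * u x ^ (p + 1)) from
      integral_add i5 i3, energy_sol hu hupos hequ hψ hc] at h
  linarith

lemma main_aux (hN : 3 ≤ N) (ha : 0 ≤ a) (hp : 1 < p)
    (hsub : p < ((N : ℝ) + 2 + 2 * a) / ((N : ℝ) - 2))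
    (hu : ContDiff ℝ 2 u) (hupos : ∀ x, 0 < u x)
    (hequ : ∀ x, -lap u x = ‖x‖ ^ a * u x ^ p)
    (K : Set (EuclideanSpace ℝ (Fin N))) (hK : IsCompact K)
    (hstable : ∀ φ : EuclideanSpace ℝ (Fin N) → ℝ,
      ContDiff ℝ 1 φ → HasCompactSupport φ → Disjoint (tsupport φ) K →
      0 ≤ (∫ x, ‖gradient φ x‖ ^ 2) - p * ∫ x, ‖x‖ ^ a * u x ^ (p - 1) * φ x ^ 2) :
    (∫ x, P u u x) = (∫ x, ‖x‖ ^ a * u x ^ (p + 1)) ∧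
    (1 - (N : ℝ) / 2) * (∫ x, P u u x)
      + (((N : ℝ) + a) / (p + 1)) * (∫ x, ‖x‖ ^ a * u x ^ (p + 1)) = 0 := by
  have hp1 : 0 < p - 1 := by linarith
  have hp2 : 0 < p + 1 := by linarith
  have hu1 : ContDiff ℝ 1 u := hu.of_le (by norm_num)
  have hFc := continuous_F ha hu hupos (p + 1)
  have hPc := continuous_P hu1 hu1
  have hF0 : ∀ x, 0 ≤ ‖x‖ ^ a * u x ^ (p + 1) := fun x => by
    have := hupos x
    positivity
  obtain ⟨C, hC, θ, hθ⟩ := exists_cutoff' N hp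
  have t1 : ∀ R, 0 < R → ContDiff ℝ 1 (θ R) := fun R hR => (hθ R hR).1.of_le (by norm_num)
  have t2 : ∀ R, 0 < R → HasCompactSupport (θ R) := fun R hR => (hθ R hR).2.1
  have t3 : ∀ R, 0 < R → ∀ x, 0 ≤ θ R x := fun R hR => (hθ R hR).2.2.1
  have t4 : ∀ R, 0 < R → ∀ x, θ R x ≤ 1 := fun R hR => (hθ R hR).2.2.2.1
  have t5 : ∀ R, 0 < R → ∀ x, ‖x‖ ≤ R → θ R x = 1 := fun R hR => (hθ R hR).2.2.2.2.1
  have t6 : ∀ R, 0 < R → ∀ x, ‖fderiv ℝ (θ R) x‖ ≤ C / R := fun R hR => (hθ R hR).2.2.2.2.2.2.1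
  have t7 : ∀ R, 0 < R → ∀ x, ‖x‖ < R → fderiv ℝ (θ R) x = 0 :=
    fun R hR => (hθ R hR).2.2.2.2.2.2.2.1
  have t8 : ∀ R, 0 < R → ∀ x, 2 * R < ‖x‖ → fderiv ℝ (θ R) x = 0 :=
    fun R hR => (hθ R hR).2.2.2.2.2.2.2.2.1
  have t9 : ∀ R, 0 < R → ∀ x, ‖fderiv ℝ (θ R) x‖ ^ 2 ≤ C / R ^ 2 * (θ R x) ^ (4 / (p + 1)) :=
    fun R hR => (hθ R hR).2.2.2.2.2.2.2.2.2
  set ε : ℝ := (p - 1) / 4 with hε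
  have hε0 : 0 < ε := by rw [hε]; positivity
  have hcR0 : ∀ R, 0 < R → 0 ≤ cR C ε a p R := fun R hR => by unfold cR; positivity
  -- pointwise bound
  have key : ∀ R, 0 < R → ∀ x, u x ^ 2 * P (θ R) (θ R) x ≤
      ε * ({x | R ≤ ‖x‖} : Set (EuclideanSpace ℝ (Fin N))).indicator
        (fun x => θ R x ^ 2 * (‖x‖ ^ a * u x ^ (p + 1))) x
      + (closedBall (0 : EuclideanSpace ℝ (Fin N)) (2 * R)).indicator
        (fun _ => cR C ε a p R) x := by
    intro R hR x
    have n1 : 0 ≤ ({x | R ≤ ‖x‖} : Set (EuclideanSpace ℝ (Fin N))).indicator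
        (fun x => θ R x ^ 2 * (‖x‖ ^ a * u x ^ (p + 1))) x :=
      Set.indicator_nonneg (fun x _ => mul_nonneg (sq_nonneg _) (hF0 x)) x
    have n2 : 0 ≤ (closedBall (0 : EuclideanSpace ℝ (Fin N)) (2 * R)).indicator
        (fun _ => cR C ε a p R) x := Set.indicator_nonneg (fun x _ => hcR0 R hR) x
    by_cases h1 : ‖x‖ < R
    · rw [P_eq_norm', t7 R hR x h1]; simp only [norm_zero]
      have := mul_nonneg hε0.le n1
      norm_num; linarith
    by_cases h2 : 2 * R < ‖x‖
    · rw [P_eq_norm', t8 R hR x h2]; simp only [norm_zero]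
      have := mul_nonneg hε0.le n1
      norm_num; linarith
    rw [Set.indicator_of_mem (by simpa using h1), Set.indicator_of_mem (by simpa using h2)]
    refine young hC hε0 ha hp hR (not_lt.1 h1) (hupos x) (t3 R hR x) ?_
    rw [P_eq_norm']
    exact t9 R hR x
  have hmeas : ∀ R : ℝ, MeasurableSet {x : EuclideanSpace ℝ (Fin N) | R ≤ ‖x‖} := fun R =>
    (isClosed_le continuous_const continuous_norm).measurableSet
  have hcI : ∀ R, Integrable ((closedBall (0 : EuclideanSpace ℝ (Fin N)) (2 * R)).indicator
        (fun _ => cR C ε a p R)) := fun R =>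
    (integrable_indicator_iff measurableSet_closedBall).2
      (integrableOn_const (isCompact_closedBall _ _).measure_ne_top)
  have hcV : ∀ R, ∫ x, (closedBall (0 : EuclideanSpace ℝ (Fin N)) (2 * R)).indicator
        (fun _ => cR C ε a p R) x = cR C ε a p R *
      (volume : Measure (EuclideanSpace ℝ (Fin N))).real (closedBall 0 (2 * R)) := fun R => by
    rw [integral_indicator measurableSet_closedBall, setIntegral_const, smul_eq_mul, mul_comm]
  have hcT := cR_tendsto (C := C) (ε := ε) (a := a) hN hC hε0 hp hsub
  have iF : ∀ ψ : EuclideanSpace ℝ (Fin N) → ℝ, ContDiff ℝ 1 ψ → HasCompactSupport ψ →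
      Integrable (fun x => ψ x ^ 2 * (‖x‖ ^ a * u x ^ (p + 1))) := fun ψ hψ hc =>
    ((hψ.continuous.pow 2).mul hFc).integrable_of_hasCompactSupport (hcs_sq hc).mul_right
  have iP : ∀ ψ : EuclideanSpace ℝ (Fin N) → ℝ, ContDiff ℝ 1 ψ → HasCompactSupport ψ →
      Integrable (fun x => ψ x ^ 2 * P u u x) := fun ψ hψ hc =>
    ((hψ.continuous.pow 2).mul hPc).integrable_of_hasCompactSupport (hcs_sq hc).mul_right
  have iD : ∀ ψ : EuclideanSpace ℝ (Fin N) → ℝ, ContDiff ℝ 1 ψ → HasCompactSupport ψ →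
      Integrable (fun x => u x ^ 2 * P ψ ψ x) := fun ψ hψ hc =>
    ((hu.continuous.pow 2).mul (continuous_P hψ hψ)).integrable_of_hasCompactSupport
      (hcs_P hc).mul_left
  have iX : ∀ ψ : EuclideanSpace ℝ (Fin N) → ℝ, ContDiff ℝ 1 ψ → HasCompactSupport ψ →
      Integrable (fun x => 2 * (ψ x * u x * P u ψ x)) := fun ψ hψ hc =>
    (((hψ.continuous.mul hu.continuous).mul
      (continuous_P hu1 hψ)).integrable_of_hasCompactSupport (hcs_P hc).mul_left).const_mul 2
  -- integrability of the weighted power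
  have hFI : Integrable (fun x => ‖x‖ ^ a * u x ^ (p + 1)) := by
    obtain ⟨R0, hR0, hKR⟩ := hK.isBounded.subset_ball_lt 0 0
    set χ : EuclideanSpace ℝ (Fin N) → ℝ := fun x => 1 - θ R0 x with hχ
    have c1 : ContDiff ℝ 1 χ := contDiff_const.sub (t1 R0 hR0)
    have c2 : ∀ x, 2 * R0 ≤ ‖x‖ → χ x = 1 := fun x hx => by
      simp [hχ, (hθ R0 hR0).2.2.2.2.2.1 x hx]
    have cPc : HasCompactSupport (P χ χ) := by
      refine ((t2 R0 hR0).fderiv (𝕜 := ℝ)).mono ?_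
      intro x hx
      rw [Function.mem_support] at hx ⊢
      intro h
      apply hx
      rw [P_eq_norm', hχ, fderiv_const_sub, h]; simp
    have iA : Integrable (fun x => u x ^ 2 * P χ χ x) :=
      ((hu.continuous.pow 2).mul (continuous_P c1 c1)).integrable_of_hasCompactSupport
        cPc.mul_left
    set A := ∫ x, u x ^ 2 * P χ χ x with hA
    have bound : ∀ R, 2 * R0 ≤ R → 0 < R →
        (p - 1) / 2 * ∫ x, (χ x * θ R x) ^ 2 * (‖x‖ ^ a * u x ^ (p + 1)) ≤
        2 * A + 2 * (cR C ε a p R *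
          (volume : Measure (EuclideanSpace ℝ (Fin N))).real (closedBall 0 (2 * R))) := by
      intro R hRR hR
      have d1 : ContDiff ℝ 1 (fun x => χ x * θ R x) := c1.mul (t1 R hR)
      have d2 : HasCompactSupport (fun x => χ x * θ R x) := (t2 R hR).mul_left
      have d3 : Disjoint (tsupport (fun x => χ x * θ R x)) K := by
        have : tsupport (fun x => χ x * θ R x) ⊆ (ball 0 R0)ᶜ := by
          refine closure_minimal ?_ isOpen_ball.isClosed_compl
          intro x hx hx2
          apply hx
          have : θ R0 x = 1 := t5 R0 hR0 x (by simpa using (mem_ball_zero_iff.1 hx2).le)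
          simp [hχ, this]
        exact (Set.disjoint_compl_left_iff_subset.2 hKR).mono_left this
      have h := stab ha hu hupos hequ hstable d1 d2 d3
      have hle : ∫ x, u x ^ 2 * P (fun x => χ x * θ R x) (fun x => χ x * θ R x) x ≤
          ∫ x, (2 * (u x ^ 2 * P χ χ x) + 2 * (ε * ((χ x * θ R x) ^ 2 * (‖x‖ ^ a * u x ^ (p + 1)))
            + (closedBall (0 : EuclideanSpace ℝ (Fin N)) (2 * R)).indicator
              (fun _ => cR C ε a p R) x)) := by
        refine integral_mono (iD _ d1 d2) ((iA.const_mul 2).add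
          ((((iF _ d1 d2).const_mul ε).add (hcI R)).const_mul 2)) fun x => ?_
        have q1 := P_mul_le (c1.differentiable one_ne_zero x) ((t1 R hR).differentiable one_ne_zero x)
        have q2 : u x ^ 2 * (θ R x ^ 2 * P χ χ x) ≤ u x ^ 2 * P χ χ x := by
          refine mul_le_mul_of_nonneg_left ?_ (sq_nonneg _)
          exact mul_le_of_le_one_left (P_nonneg _ _) (pow_le_one₀ (t3 R hR x) (t4 R hR x))
        have n2 : 0 ≤ (closedBall (0 : EuclideanSpace ℝ (Fin N)) (2 * R)).indicator
          (fun _ => cR C ε a p R) x := Set.indicator_nonneg (fun x _ => hcR0 R hR) x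
        have q3 : u x ^ 2 * (χ x ^ 2 * P (θ R) (θ R) x) ≤
            ε * ((χ x * θ R x) ^ 2 * (‖x‖ ^ a * u x ^ (p + 1)))
            + (closedBall (0 : EuclideanSpace ℝ (Fin N)) (2 * R)).indicator
              (fun _ => cR C ε a p R) x := by
          by_cases hx : R ≤ ‖x‖
          · have := key R hR x
            rw [Set.indicator_of_mem (by exact hx)] at this
            rw [c2 x (hRR.trans hx)]
            simpa using this
          · rw [P_eq_norm', t7 R hR x (not_le.1 hx)]
            have := mul_nonneg hε0.le (mul_nonneg (sq_nonneg (χ x * θ R x)) (hF0 x))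
            simp only [norm_zero]
            norm_num
            linarith
        have q4 := mul_le_mul_of_nonneg_left q1 (sq_nonneg (u x))
        simp only
        linarith
      have iS : Integrable (fun x => ε * ((χ x * θ R x) ^ 2 * (‖x‖ ^ a * u x ^ (p + 1)))
            + (closedBall (0 : EuclideanSpace ℝ (Fin N)) (2 * R)).indicator
              (fun _ => cR C ε a p R) x) := ((iF _ d1 d2).const_mul ε).add (hcI R)
      rw [integral_add (iA.const_mul 2) (iS.const_mul 2),
        integral_const_mul, integral_const_mul] at hle
      rw [show (∫ x, (ε * ((χ x * θ R x) ^ 2 * (‖x‖ ^ a * u x ^ (p + 1)))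
            + (closedBall (0 : EuclideanSpace ℝ (Fin N)) (2 * R)).indicator
              (fun _ => cR C ε a p R) x)) = _ from
          integral_add ((iF _ d1 d2).const_mul ε) (hcI R), integral_const_mul, hcV] at hle
      have := h.trans hle
      rw [hε] at this ⊢
      linarith
    set J := ∫ x in ball 0 (2 * R0), ‖x‖ ^ a * u x ^ (p + 1) with hJ
    have iJ : Integrable ((ball 0 (2 * R0)).indicator (fun x => ‖x‖ ^ a * u x ^ (p + 1))) :=
      (integrable_indicator_iff measurableSet_ball).2
        ((hFc.continuousOn.integrableOn_compact (isCompact_closedBall 0 (2 * R0))).mono_set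
          ball_subset_closedBall)
    refine integrable_of_cutoff_bound (I := J + (2 * A + 2 * 1) / ((p - 1) / 2)) hFc hF0 ?_
    filter_upwards [hcT.eventually_le_const one_pos, eventually_ge_atTop (2 * R0),
      eventually_gt_atTop 0] with R r1 r2 r3
    have d1 : ContDiff ℝ 1 (fun x => χ x * θ R x) := c1.mul (t1 R r3)
    have d2 : HasCompactSupport (fun x => χ x * θ R x) := (t2 R r3).mul_left
    have hb := bound R r2 r3
    have hs := setInt_le (R := R) hFc (iJ.add (iF _ d1 d2))
      (fun x => add_nonneg (Set.indicator_nonneg (fun x _ => hF0 x) x)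
        (mul_nonneg (sq_nonneg _) (hF0 x))) (fun x hx => by
        simp only [Pi.add_apply]
        by_cases h : ‖x‖ < 2 * R0
        · rw [Set.indicator_of_mem (by simpa using h)]
          have := mul_nonneg (sq_nonneg (χ x * θ R x)) (hF0 x)
          linarith
        · have := Set.indicator_nonneg (s := ball 0 (2 * R0)) (fun x _ => hF0 x) x
          rw [c2 x (not_lt.1 h), t5 R r3 x hx.le]
          linarith)
    have e : ∫ x, ((ball 0 (2 * R0)).indicator (fun x => ‖x‖ ^ a * u x ^ (p + 1)) + 
      fun x => (χ x * θ R x) ^ 2 * (‖x‖ ^ a * u x ^ (p + 1))) x = J + 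
      ∫ x, (χ x * θ R x) ^ 2 * (‖x‖ ^ a * u x ^ (p + 1)) := by
      rw [integral_add' iJ (iF _ d1 d2), integral_indicator measurableSet_ball]
    rw [e] at hs
    have : ∫ x, (χ x * θ R x) ^ 2 * (‖x‖ ^ a * u x ^ (p + 1)) ≤ (2 * A + 2 * 1) / ((p - 1) / 2) := by
      rw [le_div_iff₀ (by positivity)]
      linarith
    linarith
  -- the cutoff error tends to zero
  have hX : Tendsto (fun R => ∫ x, u x ^ 2 * P (θ R) (θ R) x) atTop (𝓝 0) := by
    have hT := ((tail_tendsto hFI).const_mul ε).add hcT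
    rw [mul_zero, add_zero] at hT
    refine tendsto_of_tendsto_of_tendsto_of_le_of_le' tendsto_const_nhds hT ?_ ?_
    · exact Eventually.of_forall fun R => integral_nonneg fun x =>
        mul_nonneg (sq_nonneg _) (P_nonneg _ _)
    · filter_upwards [eventually_gt_atTop 0] with R hR
      rw [← hcV, ← integral_const_mul, ← integral_add ((hFI.indicator (hmeas R)).const_mul ε) (hcI R)]
      refine integral_mono (iD _ (t1 R hR) (t2 R hR))
        (((hFI.indicator (hmeas R)).const_mul ε).add (hcI R)) fun x => ?_
      refine (key R hR x).trans ?_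
      refine add_le_add (mul_le_mul_of_nonneg_left ?_ hε0.le) le_rfl
      exact Set.indicator_le_indicator (mul_le_of_le_one_left (hF0 x) (pow_le_one₀ (t3 R hR x) (t4 R hR x)))
  have hθ2 : ∀ f : EuclideanSpace ℝ (Fin N) → ℝ, Integrable f →
      Tendsto (fun R : ℝ => ∫ x, θ R x ^ 2 * f x) atTop (𝓝 (∫ x, f x)) := fun f hf =>
    mass_tendsto (θ := fun R x => θ R x ^ 2) hf (fun R hR => (t1 R hR).continuous.pow 2)
      (fun R hR x => sq_nonneg _) (fun R hR x => pow_le_one₀ (t3 R hR x) (t4 R hR x))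
      (fun R hR x hx => by simp [t5 R hR x hx])
  have hFle : ∀ R, 0 < R → ∫ x, θ R x ^ 2 * (‖x‖ ^ a * u x ^ (p + 1)) ≤
      ∫ x, ‖x‖ ^ a * u x ^ (p + 1) := fun R hR =>
    integral_mono (iF _ (t1 R hR) (t2 R hR)) hFI fun x =>
      mul_le_of_le_one_left (hF0 x) (pow_le_one₀ (t3 R hR x) (t4 R hR x))
  have hEn : ∀ R, 0 < R → (∫ x, θ R x ^ 2 * P u u x) + (∫ x, 2 * (θ R x * u x * P u (θ R) x))
      - (∫ x, θ R x ^ 2 * (‖x‖ ^ a * u x ^ (p + 1))) = 0 := by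
    intro R hR
    have h := energy_sol hu hupos hequ (t1 R hR) (t2 R hR)
    have j1 := iP _ (t1 R hR) (t2 R hR)
    have j2 := iX _ (t1 R hR) (t2 R hR)
    have j3 := iF _ (t1 R hR) (t2 R hR)
    have j12 : Integrable (fun x => θ R x ^ 2 * P u u x + 2 * (θ R x * u x * P u (θ R) x)) :=
      j1.add j2
    rw [← integral_add j1 j2, ← integral_sub j12 j3]
    exact h
  -- integrability of the gradient
  have hPI : Integrable (P u u) := by
    set I := ∫ x, ‖x‖ ^ a * u x ^ (p + 1) with hI
    refine integrable_of_cutoff_bound (I := 2 * (I + 2 * 1)) hPc (P_nonneg u) ?_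
    filter_upwards [hX.eventually_le_const one_pos, eventually_gt_atTop 0] with R r1 hR
    have j1 := iP _ (t1 R hR) (t2 R hR)
    have j2 := iX _ (t1 R hR) (t2 R hR)
    have j4 := iD _ (t1 R hR) (t2 R hR)
    have hs := setInt_le (R := R) hPc j1 (fun x => mul_nonneg (sq_nonneg _) (P_nonneg u x))
      (fun x hx => by rw [t5 R hR x hx.le]; simp)
    have hc : ∫ x, -((1 / 2) * (θ R x ^ 2 * P u u x) + 2 * (u x ^ 2 * P (θ R) (θ R) x)) ≤
        ∫ x, 2 * (θ R x * u x * P u (θ R) x) := by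
      refine integral_mono (((j1.const_mul (1 / 2)).add (j4.const_mul 2)).neg) j2 fun x => ?_
      have := cross_le' (f := u) (g := θ R) (x := x) (θ R x) (u x)
      simp only
      linarith
    rw [integral_neg, integral_add (j1.const_mul (1 / 2)) (j4.const_mul 2), integral_const_mul,
      integral_const_mul] at hc
    have := hEn R hR
    have := hFle R hR
    linarith
  -- the cross term tends to zero
  have hcross : Tendsto (fun R => ∫ x, 2 * (θ R x * u x * P u (θ R) x)) atTop (𝓝 0) := by
    have hT := (tail_tendsto hPI).add hX
    rw [add_zero] at hT
    refine squeeze_zero_norm' ?_ hT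
    filter_upwards [eventually_gt_atTop 0] with R hR
    have j4 := iD _ (t1 R hR) (t2 R hR)
    rw [← integral_add (hPI.indicator (hmeas R)) j4]
    refine norm_integral_le_of_norm_le ((hPI.indicator (hmeas R)).add j4)
      (Eventually.of_forall fun x => ?_)
    rw [Real.norm_eq_abs]
    by_cases hx : R ≤ ‖x‖
    · rw [Set.indicator_of_mem (by exact hx)]
      refine (cross_le _ _).trans ?_
      have := mul_le_of_le_one_left (P_nonneg u x) (pow_le_one₀ (n := 2) (t3 R hR x) (t4 R hR x))
      linarith
    · have h0 : P u (θ R) x = 0 := by simp [P, D, t7 R hR x (not_le.1 hx)]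
      rw [h0]
      have := Set.indicator_nonneg (s := {x | R ≤ ‖x‖}) (fun x _ => P_nonneg u x) x
      have := mul_nonneg (sq_nonneg (u x)) (P_nonneg (θ R) x)
      simp only [mul_zero, abs_zero]
      linarith
  refine ⟨?_, ?_⟩
  · have hT := ((hθ2 _ hPI).add hcross).sub (hθ2 _ hFI)
    have hz : Tendsto (fun _ : ℝ => (0 : ℝ)) atTop (𝓝 0) := tendsto_const_nhds
    have := tendsto_nhds_unique (hT.congr' (by
      filter_upwards [eventually_gt_atTop 0] with R hR using hEn R hR)) hz
    linarith
  · -- Pohozaev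
    have hθ1 : ∀ f : EuclideanSpace ℝ (Fin N) → ℝ, Integrable f →
        Tendsto (fun R : ℝ => ∫ x, θ R x * f x) atTop (𝓝 (∫ x, f x)) := fun f hf =>
      mass_tendsto hf (fun R hR => (t1 R hR).continuous) t3 t4 t5
    set Q : EuclideanSpace ℝ (Fin N) → ℝ := fun x => (1 - (N : ℝ) / 2) * P u u x
      + (((N : ℝ) + a) / (p + 1)) * (‖x‖ ^ a * u x ^ (p + 1)) with hQ
    have hQI : Integrable Q := (hPI.const_mul _).add (hFI.const_mul _)
    have hQe : ∫ x, Q x = (1 - (N : ℝ) / 2) * (∫ x, P u u x)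
      + (((N : ℝ) + a) / (p + 1)) * (∫ x, ‖x‖ ^ a * u x ^ (p + 1)) := by
      rw [hQ, integral_add (hPI.const_mul _) (hFI.const_mul _), integral_const_mul,
        integral_const_mul]
    rw [← hQe]
    set Er : ℝ → EuclideanSpace ℝ (Fin N) → ℝ := fun R x =>
      (fderiv ℝ u x x * P u (θ R) x - fderiv ℝ (θ R) x x * P u u x / 2)
        + fderiv ℝ (θ R) x x * (‖x‖ ^ a * u x ^ (p + 1)) / (p + 1) with hEr
    have hbig : ∀ R, 0 < R → Integrable (Er R) ∧ (∫ x, θ R x * Q x) + ∫ x, Er R x = 0 := by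
      intro R hR
      have hθd := t1 R hR
      have hθs := t2 R hR
      have cu : Continuous (fun x => fderiv ℝ u x x) :=
        (hu1.continuous_fderiv one_ne_zero).clm_apply continuous_id
      have cθ : Continuous (fun x => fderiv ℝ (θ R) x x) :=
        (hθd.continuous_fderiv one_ne_zero).clm_apply continuous_id
      have sθ : HasCompactSupport (fun x => fderiv ℝ (θ R) x x) := by
        refine (hθs.fderiv (𝕜 := ℝ)).mono ?_
        intro x hx
        rw [Function.mem_support] at hx ⊢
        intro h
        exact hx (by simp [h])
      have k1 : Integrable (fun x => fderiv ℝ u x x * P u (θ R) x) :=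
        (cu.mul (continuous_P hu1 hθd)).integrable_of_hasCompactSupport (hcs_P hθs).mul_left
      have k2 : Integrable (fun x => fderiv ℝ (θ R) x x * P u u x / 2) :=
        ((cθ.mul hPc).integrable_of_hasCompactSupport sθ.mul_right).div_const 2
      have k3 : Integrable (fun x => fderiv ℝ (θ R) x x * (‖x‖ ^ a * u x ^ (p + 1)) / (p + 1)) :=
        ((cθ.mul hFc).integrable_of_hasCompactSupport sθ.mul_right).div_const _
      have kE : Integrable (Er R) := (k1.sub k2).add k3
      refine ⟨kE, ?_⟩
      have kQ : Integrable (fun x => θ R x * Q x) := by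
        refine hQI.norm.mono' (hθd.continuous.aestronglyMeasurable.mul hQI.aestronglyMeasurable)
          (Eventually.of_forall fun x => ?_)
        rw [norm_mul, Real.norm_of_nonneg (t3 R hR x)]
        exact mul_le_of_le_one_left (norm_nonneg _) (t4 R hR x)
      have up : ContDiff ℝ 1 (fun x => u x ^ (p + 1)) :=
        hu1.rpow_const_of_ne fun x => (hupos x).ne'
      have hg : ContDiff ℝ 1 (fun x => θ R x * u x ^ (p + 1)) := hθd.mul up
      have w := weight_int ha hg hθs.mul_right
      have z := poho hu hθd hθs
      have dg : ∀ x, fderiv ℝ (fun x => θ R x * u x ^ (p + 1)) x x =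
          fderiv ℝ (θ R) x x * u x ^ (p + 1) + θ R x * ((p + 1) * u x ^ p * fderiv ℝ u x x) := by
        intro x
        rw [fderiv_fun_mul (hθd.differentiable one_ne_zero x) (up.differentiable one_ne_zero x)]
        have h1 := ((hu1.differentiable one_ne_zero x).hasFDerivAt.rpow_const (p := p + 1)
          (Or.inl (hupos x).ne')).fderiv
        rw [h1]
        simp
        ring
      have lz : ∀ x, lap u x = -(‖x‖ ^ a * u x ^ p) := fun x => by linarith [hequ x]
      simp only [lz] at z
      simp only [dg] at w
      have cW := continuous_F ha hu hupos p
      have m1 : Integrable (fun x => θ R x * (fderiv ℝ u x x * -(‖x‖ ^ a * u x ^ p))) :=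
        (hθd.continuous.mul (cu.mul cW.neg)).integrable_of_hasCompactSupport hθs.mul_right
      have m2 : Integrable (fun x => θ R x * ((1 - (N : ℝ) / 2) * P u u x)) :=
        (hθd.continuous.mul (continuous_const.mul hPc)).integrable_of_hasCompactSupport
          hθs.mul_right
      have mz : Integrable (fun x => θ R x * ((1 - (N : ℝ) / 2) * P u u x)
        + θ R x * (fderiv ℝ u x x * -(‖x‖ ^ a * u x ^ p))
        + (fderiv ℝ u x x * P u (θ R) x - fderiv ℝ (θ R) x x * P u u x / 2)) :=
        (m2.add m1).add (k1.sub k2)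
      have ew : ∀ x, (1 / (p + 1)) * (((N : ℝ) + a) * (‖x‖ ^ a * (θ R x * u x ^ (p + 1))) +
          ‖x‖ ^ a * (fderiv ℝ (θ R) x x * u x ^ (p + 1) +
            θ R x * ((p + 1) * u x ^ p * fderiv ℝ u x x))) =
          θ R x * Q x + Er R x - (θ R x * ((1 - (N : ℝ) / 2) * P u u x)
        + θ R x * (fderiv ℝ u x x * -(‖x‖ ^ a * u x ^ p))
        + (fderiv ℝ u x x * P u (θ R) x - fderiv ℝ (θ R) x x * P u u x / 2)) := by
        intro x
        simp only [hQ, hEr]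
        field_simp
        ring
      have w2 := congrArg (fun t => (1 / (p + 1)) * t) w
      rw [← integral_const_mul, mul_zero] at w2
      simp only [ew] at w2
      have kQE : Integrable (fun x => θ R x * Q x + Er R x) := kQ.add kE
      rw [integral_sub kQE mz, z, sub_zero] at w2
      rw [← integral_add kQ kE]
      exact w2
    have hErT : Tendsto (fun R => ∫ x, Er R x) atTop (𝓝 0) := by
      have hGI : Integrable (fun x => 4 * C * (P u u x + ‖x‖ ^ a * u x ^ (p + 1))) :=
        (hPI.add hFI).const_mul _
      refine squeeze_zero_norm' ?_ (tail_tendsto hGI)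
      filter_upwards [eventually_gt_atTop 0] with R hR
      refine norm_integral_le_of_norm_le (hGI.indicator (hmeas R))
        (Eventually.of_forall fun x => ?_)
      have hG0 : ∀ x, 0 ≤ 4 * C * (P u u x + ‖x‖ ^ a * u x ^ (p + 1)) := fun x =>
        mul_nonneg (by positivity) (add_nonneg (P_nonneg u x) (hF0 x))
      by_cases hz : fderiv ℝ (θ R) x = 0
      · have : Er R x = 0 := by simp [hEr, hz, P, D]
        rw [this, norm_zero]
        exact Set.indicator_nonneg (fun x _ => hG0 x) x
      have hx1 : R ≤ ‖x‖ := by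
        by_contra h; exact hz (t7 R hR x (not_le.1 h))
      have hx2 : ‖x‖ ≤ 2 * R := by
        by_contra h; exact hz (t8 R hR x (not_le.1 h))
      rw [Set.indicator_of_mem (by exact hx1)]
      have hT : ‖fderiv ℝ (θ R) x‖ * ‖x‖ ≤ 2 * C := by
        calc _ ≤ C / R * (2 * R) := by gcongr; exact t6 R hR x
          _ = 2 * C := by field_simp
      have b1 : |fderiv ℝ (θ R) x x| ≤ 2 * C :=
        ((fderiv ℝ (θ R) x).le_opNorm x).trans hT
      have b2 : |P u (θ R) x| ≤ ‖fderiv ℝ u x‖ * ‖fderiv ℝ (θ R) x‖ := by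
        refine abs_le_of_sq_le_sq ?_ (by positivity)
        rw [mul_pow, ← P_eq_norm', ← P_eq_norm']
        exact P_sq_le _ _ _
      have b3 : |fderiv ℝ u x x| ≤ ‖fderiv ℝ u x‖ * ‖x‖ := (fderiv ℝ u x).le_opNorm x
      have b4 : |fderiv ℝ u x x * P u (θ R) x| ≤ 2 * C * P u u x := by
        rw [abs_mul, P_eq_norm']
        calc _ ≤ (‖fderiv ℝ u x‖ * ‖x‖) * (‖fderiv ℝ u x‖ * ‖fderiv ℝ (θ R) x‖) := by gcongr
          _ = (‖fderiv ℝ (θ R) x‖ * ‖x‖) * ‖fderiv ℝ u x‖ ^ 2 := by ring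
          _ ≤ _ := by gcongr
      have b5 : |fderiv ℝ (θ R) x x * P u u x / 2| ≤ C * P u u x := by
        rw [abs_div, abs_mul, abs_of_nonneg (P_nonneg u x), abs_two]
        have := mul_le_mul_of_nonneg_right b1 (P_nonneg u x)
        linarith
      have b6 : |fderiv ℝ (θ R) x x * (‖x‖ ^ a * u x ^ (p + 1)) / (p + 1)| ≤
          2 * C * (‖x‖ ^ a * u x ^ (p + 1)) := by
        rw [abs_div, abs_mul, abs_of_nonneg (hF0 x), abs_of_pos hp2]
        refine (div_le_self (mul_nonneg (abs_nonneg _) (hF0 x)) (by linarith)).trans ?_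
        exact mul_le_mul_of_nonneg_right b1 (hF0 x)
      rw [Real.norm_eq_abs, hEr]
      refine (abs_add_le _ _).trans ?_
      refine (add_le_add (abs_sub _ _) le_rfl).trans ?_
      have := mul_nonneg hC.le (P_nonneg u x)
      have := mul_nonneg hC.le (hF0 x)
      linarith
    have hT := (hθ1 _ hQI).add hErT
    have hz : Tendsto (fun _ : ℝ => (0 : ℝ)) atTop (𝓝 0) := tendsto_const_nhds
    have := tendsto_nhds_unique (hT.congr' (by
      filter_upwards [eventually_gt_atTop 0] with R hR using (hbig R hR).2)) hz
    linarith

end main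

end Henon

/-- **Pohozaev identity on all of `ℝ^N` for solutions of the Hénon equation stable outside a
compact set.** Let `a ≥ 0`, `N ≥ 3`, `1 < p < (N+2+2a)/(N-2)`, and let `u` be a positive
`C²` solution of `-Δu = |x|^a u^p` on `ℝ^N` which is stable outside a compact set.  Then
`((N-2)/2) ∫ |∇u|² = ((N+a)/(p+1)) ∫ |x|^a u^(p+1)`, and combined with the energy identity
this forces `((N+a)/(p+1) - (N-2)/2) ∫ |x|^a u^(p+1) = 0`. -/
theorem henon_global_pohozaev_identity
    (N : ℕ) (hN : 3 ≤ N) (a p : ℝ) (ha : 0 ≤ a) (hp : 1 < p)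
    (hsub : p < ((N : ℝ) + 2 + 2 * a) / ((N : ℝ) - 2))
    (u : EuclideanSpace ℝ (Fin N) → ℝ)
    (hu : ContDiff ℝ 2 u) (hupos : ∀ x, 0 < u x)
    (hequ : ∀ x, -lap u x = ‖x‖ ^ a * u x ^ p)
    (K : Set (EuclideanSpace ℝ (Fin N))) (hK : IsCompact K)
    (hstable : ∀ φ : EuclideanSpace ℝ (Fin N) → ℝ,
      ContDiff ℝ 1 φ → HasCompactSupport φ → Disjoint (tsupport φ) K →
      0 ≤ (∫ x, ‖gradient φ x‖ ^ 2) - p * ∫ x, ‖x‖ ^ a * u x ^ (p - 1) * φ x ^ 2) :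
    (((N : ℝ) - 2) / 2) * (∫ x, ‖gradient u x‖ ^ 2) =
      (((N : ℝ) + a) / (p + 1)) * (∫ x, ‖x‖ ^ a * u x ^ (p + 1)) ∧
    (((N : ℝ) + a) / (p + 1) - ((N : ℝ) - 2) / 2) * (∫ x, ‖x‖ ^ a * u x ^ (p + 1)) = 0 := by
  obtain ⟨h1, h2⟩ := Henon.main_aux hN ha hp hsub hu hupos hequ K hK hstable
  simp only [Henon.P_eq_norm] at h1 h2
  constructor
  · linarith
  · rw [h1] at h2
    linarith
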